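/- arXiv:1205.5160 — 9 statements merged into one kernel-verified Lean document; each statement's English description precedes it below -/
import Mathlib

section
/- Let k be a field, V a k-vector space of finite dimension r ≥ 2, and (F^x_•, F^y_•, l) a generic triple in V. Let W ⊆ V be a linear subspace with l ⊆ W. Then for every 2 ≤ i ≤ r+1 the three subspaces l, W ∩ F^x_i and W ∩ F^y_{r+3-i} form a direct sum inside W, so that dim(W ∩ F^x_i) + dim(W ∩ F^y_{r+3-i}) ≤ dim W − 1. In particular dim(W ∩ F^x_2) ≤ dim W − 1 and dim(W ∩ F^y_2) ≤ dim W − 1. -/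
/-- A full flag in an `r`-dimensional vector space `V`:
a chain `V = F 1 ⊃ F 2 ⊃ ⋯ ⊃ F r ⊃ F (r+1) = 0` with `dim (F i) = r - i + 1`. -/
def IsFullFlag (k : Type*) [Field k] (V : Type*) [AddCommGroup V] [Module k V]
    (r : ℕ) (F : ℕ → Submodule k V) : Prop :=
  (∀ i, 1 ≤ i → i ≤ r → F (i + 1) ≤ F i) ∧
  (∀ i, 1 ≤ i → i ≤ r + 1 → Module.finrank k (F i) = r + 1 - i)

/-- A pair of full flags is generic if
`dim (Fx i + Fy j) = min r (dim (Fx i) + dim (Fy j))` for all `1 ≤ i, j ≤ r+1`. -/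
def IsGenericPair (k : Type*) [Field k] (V : Type*) [AddCommGroup V] [Module k V]
    (r : ℕ) (Fx Fy : ℕ → Submodule k V) : Prop :=
  IsFullFlag k V r Fx ∧ IsFullFlag k V r Fy ∧
  ∀ i j, 1 ≤ i → i ≤ r + 1 → 1 ≤ j → j ≤ r + 1 →
    Module.finrank k ↥(Fx i ⊔ Fy j) =
      min r (Module.finrank k (Fx i) + Module.finrank k (Fy j))

/-- A generic triple: a generic pair of full flags together with a line `l` with
`dim (l + Fx i + Fy j) = min (1 + dim (Fx i) + dim (Fy j)) r` for all `1 ≤ i, j ≤ r+1`. -/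
def IsGenericTriple (k : Type*) [Field k] (V : Type*) [AddCommGroup V] [Module k V]
    (r : ℕ) (Fx Fy : ℕ → Submodule k V) (l : Submodule k V) : Prop :=
  IsGenericPair k V r Fx Fy ∧ Module.finrank k l = 1 ∧
  ∀ i j, 1 ≤ i → i ≤ r + 1 → 1 ≤ j → j ≤ r + 1 →
    Module.finrank k ↥(l ⊔ Fx i ⊔ Fy j) =
      min (1 + Module.finrank k (Fx i) + Module.finrank k (Fy j)) r

/-- Subspaces whose dimensions add up in their sum intersect trivially. -/
theorem Submodule.inf_eq_bot_of_finrank_add_le_finrank_sup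
    {k V : Type*} [Field k] [AddCommGroup V] [Module k V] [FiniteDimensional k V]
    {A B : Submodule k V}
    (h : Module.finrank k A + Module.finrank k B ≤ Module.finrank k ↥(A ⊔ B)) :
    A ⊓ B = ⊥ := by
  have := Submodule.finrank_sup_add_finrank_inf_eq A B
  exact Submodule.finrank_eq_zero.mp (by omega)

/-- For a generic triple in an `r`-dimensional space (`r ≥ 2`) and any subspace `W`
containing `l`, for `2 ≤ i ≤ r+1` the subspaces `l`, `W ⊓ Fx i` and `W ⊓ Fy (r+3-i)`
form a direct sum inside `W`, so that
`dim (W ⊓ Fx i) + dim (W ⊓ Fy (r+3-i)) ≤ dim W - 1`; in particular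
`dim (W ⊓ Fx 2) ≤ dim W - 1` and `dim (W ⊓ Fy 2) ≤ dim W - 1`. -/
theorem generic_triple_subspace_dim_bound
    (k : Type*) [Field k] (V : Type*) [AddCommGroup V] [Module k V]
    [FiniteDimensional k V] (r : ℕ) (hr : 2 ≤ r) (hV : Module.finrank k V = r)
    (Fx Fy : ℕ → Submodule k V) (l : Submodule k V)
    (h : IsGenericTriple k V r Fx Fy l)
    (W : Submodule k V) (hlW : l ≤ W) :
    (∀ i, 2 ≤ i → i ≤ r + 1 →
      (W ⊓ Fx i) ⊓ (W ⊓ Fy (r + 3 - i)) = ⊥ ∧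
      l ⊓ ((W ⊓ Fx i) ⊔ (W ⊓ Fy (r + 3 - i))) = ⊥ ∧
      Module.finrank k ↥(W ⊓ Fx i) + Module.finrank k ↥(W ⊓ Fy (r + 3 - i)) ≤
        Module.finrank k W - 1) ∧
    Module.finrank k ↥(W ⊓ Fx 2) ≤ Module.finrank k W - 1 ∧
    Module.finrank k ↥(W ⊓ Fy 2) ≤ Module.finrank k W - 1 := by
  obtain ⟨⟨⟨-, hx⟩, ⟨-, hy⟩, hxy⟩, hl, hlxy⟩ := h
  have key : ∀ i, 2 ≤ i → i ≤ r + 1 →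
      (W ⊓ Fx i) ⊓ (W ⊓ Fy (r + 3 - i)) = ⊥ ∧
      l ⊓ ((W ⊓ Fx i) ⊔ (W ⊓ Fy (r + 3 - i))) = ⊥ ∧
      Module.finrank k ↥(W ⊓ Fx i) + Module.finrank k ↥(W ⊓ Fy (r + 3 - i)) ≤
        Module.finrank k W - 1 := by
    intro i hi hir
    have hxi := hx i (by omega) hir
    have hyi := hy (r + 3 - i) (by omega) (by omega)
    have hsup := hxy i (r + 3 - i) (by omega) hir (by omega) (by omega)
    have hlsup := hlxy i (r + 3 - i) (by omega) hir (by omega) (by omega)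
    rw [sup_assoc] at hlsup
    have hinf : Fx i ⊓ Fy (r + 3 - i) = ⊥ :=
      Submodule.inf_eq_bot_of_finrank_add_le_finrank_sup (by omega)
    have hlinf : l ⊓ (Fx i ⊔ Fy (r + 3 - i)) = ⊥ :=
      Submodule.inf_eq_bot_of_finrank_add_le_finrank_sup (by omega)
    have hWinf : (W ⊓ Fx i) ⊓ (W ⊓ Fy (r + 3 - i)) = ⊥ :=
      eq_bot_mono (inf_le_inf inf_le_right inf_le_right) hinf
    have hWlinf : l ⊓ ((W ⊓ Fx i) ⊔ (W ⊓ Fy (r + 3 - i))) = ⊥ :=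
      eq_bot_mono (inf_le_inf_left l (sup_le_sup inf_le_right inf_le_right)) hlinf
    refine ⟨hWinf, hWlinf, ?_⟩
    have hdim := Submodule.finrank_sup_add_finrank_inf_eq (W ⊓ Fx i) (W ⊓ Fy (r + 3 - i))
    have hldim := Submodule.finrank_sup_add_finrank_inf_eq l
      ((W ⊓ Fx i) ⊔ (W ⊓ Fy (r + 3 - i)))
    rw [hWinf, finrank_bot] at hdim
    rw [hWlinf, finrank_bot] at hldim
    have hle : Module.finrank k ↥(l ⊔ ((W ⊓ Fx i) ⊔ (W ⊓ Fy (r + 3 - i)))) ≤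
        Module.finrank k W :=
      Submodule.finrank_mono (sup_le hlW (sup_le inf_le_left inf_le_left))
    omega
  refine ⟨key, ?_, ?_⟩
  · have := (key 2 le_rfl (by omega)).2.2
    omega
  · have := (key (r + 1) (by omega) le_rfl).2.2
    rw [show r + 3 - (r + 1) = 2 by omega] at this
    omega
end

section
/- Let k be a field, V a k-vector space of finite dimension r ≥ 2, (F^x_•, F^y_•, l) a generic triple in V, and W ⊆ V a linear subspace with W ∩ l = 0. Then deg(W) = deg_V(W) ≤ (r − 1)·dim W; in particular, if W ≠ 0 then μ(W) ≤ r − 1. -/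
/-- `deg_V(W) = Σ_{i=2}^{r} dim (W ∩ Fx i) + Σ_{i=2}^{r} dim (W ∩ Fy i)`. -/
noncomputable def degV (k : Type*) [Field k] (V : Type*) [AddCommGroup V] [Module k V]
    (r : ℕ) (Fx Fy : ℕ → Submodule k V) (W : Submodule k V) : ℕ :=
  ∑ i ∈ Finset.Icc 2 r, Module.finrank k ↥(W ⊓ Fx i) +
    ∑ i ∈ Finset.Icc 2 r, Module.finrank k ↥(W ⊓ Fy i)

/-- `deg(W) = deg_V(W) + (r-1)·dim (l ∩ W)`. -/
noncomputable def deg (k : Type*) [Field k] (V : Type*) [AddCommGroup V] [Module k V]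
    (r : ℕ) (Fx Fy : ℕ → Submodule k V) (l : Submodule k V) (W : Submodule k V) : ℕ :=
  degV k V r Fx Fy W + (r - 1) * Module.finrank k ↥(l ⊓ W)


/-- In a generic pair of flags, members of complementary dimension meet trivially. -/
theorem IsGenericPair.inf_eq_bot {k : Type*} [Field k] {V : Type*} [AddCommGroup V] [Module k V]
    [FiniteDimensional k V] {r : ℕ} {Fx Fy : ℕ → Submodule k V} (h : IsGenericPair k V r Fx Fy)
    {i j : ℕ} (hi : 1 ≤ i) (hj : 1 ≤ j) (hij : i + j = r + 2) : Fx i ⊓ Fy j = ⊥ := by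
  obtain ⟨⟨-, hx⟩, ⟨-, hy⟩, hxy⟩ := h
  have hx := hx i hi (by omega)
  have hy := hy j hj (by omega)
  have hxy := hxy i j hi (by omega) hj (by omega)
  have hsum := Submodule.finrank_sup_add_finrank_inf_eq (Fx i) (Fy j)
  rw [← Submodule.finrank_eq_zero (R := k)]
  omega

/-- Subspaces of `W` cut out by trivially intersecting subspaces have total dimension at most
`dim W`. -/
theorem Submodule.finrank_inf_add_finrank_inf_le {k : Type*} [Field k] {V : Type*}
    [AddCommGroup V] [Module k V] [FiniteDimensional k V] {A B : Submodule k V}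
    (h : A ⊓ B = ⊥) (W : Submodule k V) :
    Module.finrank k ↥(W ⊓ A) + Module.finrank k ↥(W ⊓ B) ≤ Module.finrank k W := by
  have hinf : (W ⊓ A) ⊓ (W ⊓ B) = ⊥ :=
    le_bot_iff.mp ((inf_le_inf inf_le_right inf_le_right).trans h.le)
  rw [← Submodule.finrank_sup_add_finrank_inf_eq, hinf, finrank_bot, add_zero]
  exact Submodule.finrank_mono (sup_le inf_le_left inf_le_left)

/-- For a generic pair of flags, `deg_V(W) ≤ (r-1)·dim W` for every subspace `W`. -/
theorem IsGenericPair.degV_le {k : Type*} [Field k] {V : Type*} [AddCommGroup V] [Module k V]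
    [FiniteDimensional k V] {r : ℕ} {Fx Fy : ℕ → Submodule k V} (h : IsGenericPair k V r Fx Fy)
    (W : Submodule k V) : degV k V r Fx Fy W ≤ (r - 1) * Module.finrank k W := by
  have hreflect : ∑ i ∈ Finset.Icc 2 r, Module.finrank k ↥(W ⊓ Fy i) =
      ∑ i ∈ Finset.Icc 2 r, Module.finrank k ↥(W ⊓ Fy (r + 2 - i)) := by
    refine Finset.sum_bij' (fun i _ => r + 2 - i) (fun i _ => r + 2 - i) ?_ ?_ ?_ ?_ ?_
    all_goals intro i hi
    all_goals rw [Finset.mem_Icc] at hi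
    · exact Finset.mem_Icc.mpr (by omega)
    · exact Finset.mem_Icc.mpr (by omega)
    · omega
    · omega
    · rw [show r + 2 - (r + 2 - i) = i by omega]
  rw [degV, hreflect, ← Finset.sum_add_distrib]
  refine (Finset.sum_le_card_nsmul _ _ (Module.finrank k W) fun i hi => ?_).trans_eq ?_
  · rw [Finset.mem_Icc] at hi
    exact Submodule.finrank_inf_add_finrank_inf_le
      (h.inf_eq_bot (by omega) (by omega) (by omega)) W
  · rw [Nat.card_Icc, smul_eq_mul, show r + 1 - 2 = r - 1 by omega]

/-- For a generic triple in an `r`-dimensional space (`r ≥ 2`) and a subspace `W`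
with `W ∩ l = 0`: `deg(W) = deg_V(W) ≤ (r-1)·dim W`, and if `W ≠ 0` then
`μ(W) ≤ r - 1`. -/
theorem deg_bound_of_inf_line_eq_bot
    (k : Type*) [Field k] (V : Type*) [AddCommGroup V] [Module k V]
    [FiniteDimensional k V] (r : ℕ) (hr : 2 ≤ r) (hV : Module.finrank k V = r)
    (Fx Fy : ℕ → Submodule k V) (l : Submodule k V)
    (h : IsGenericTriple k V r Fx Fy l)
    (W : Submodule k V) (hWl : W ⊓ l = ⊥) :
    deg k V r Fx Fy l W = degV k V r Fx Fy W ∧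
    degV k V r Fx Fy W ≤ (r - 1) * Module.finrank k W ∧
    (W ≠ ⊥ →
      (deg k V r Fx Fy l W : ℚ) / (Module.finrank k W : ℚ) ≤ (r : ℚ) - 1) := by
  have hdeg : deg k V r Fx Fy l W = degV k V r Fx Fy W := by
    rw [deg, inf_comm, hWl, finrank_bot, mul_zero, add_zero]
  have hle := h.1.degV_le W
  refine ⟨hdeg, hle, fun hW => ?_⟩
  have hpos : 0 < Module.finrank k W :=
    Nat.pos_of_ne_zero fun h0 => hW (Submodule.finrank_eq_zero.mp h0)
  rw [hdeg, div_le_iff₀ (by exact_mod_cast hpos), ← Nat.cast_pred (by omega : 0 < r)]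
  exact_mod_cast hle
end

section
/- Let k be a field, V a k-vector space of finite dimension r ≥ 2, (F^x_•, F^y_•, l) a generic triple in V, and W ⊆ V a linear subspace with l ⊆ W. Then deg(W) ≤ r·(dim W − 1) + (r − 1); in particular μ(W) ≤ r − 1/dim W. -/
/-- If `l`, `X`, `Y` span a space of dimension `dim l + dim X + dim Y`, then for `W ⊇ l` the
subspaces `l`, `W ∩ X`, `W ∩ Y` of `W` are independent. -/
theorem finrank_add_finrank_inf_add_finrank_inf_le {k V : Type*} [Field k] [AddCommGroup V]
    [Module k V] [FiniteDimensional k V] {l X Y W : Submodule k V} (hlW : l ≤ W)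
    (h : Module.finrank k ↥(l ⊔ X ⊔ Y) =
      Module.finrank k l + Module.finrank k X + Module.finrank k Y) :
    Module.finrank k l + Module.finrank k ↥(W ⊓ X) + Module.finrank k ↥(W ⊓ Y) ≤
      Module.finrank k W := by
  have h1 := Submodule.finrank_sup_add_finrank_inf_eq (l ⊔ X) Y
  have h2 := Submodule.finrank_sup_add_finrank_inf_eq l X
  have h3 := Submodule.finrank_sup_add_finrank_inf_eq (l ⊔ W ⊓ X) (W ⊓ Y)
  have h4 := Submodule.finrank_sup_add_finrank_inf_eq l (W ⊓ X)
  have h5 : Module.finrank k ↥((l ⊔ W ⊓ X) ⊓ (W ⊓ Y)) ≤ Module.finrank k ↥((l ⊔ X) ⊓ Y) :=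
    Submodule.finrank_mono (inf_le_inf (sup_le_sup_left inf_le_right l) inf_le_right)
  have h6 : Module.finrank k ↥(l ⊓ (W ⊓ X)) ≤ Module.finrank k ↥(l ⊓ X) :=
    Submodule.finrank_mono (inf_le_inf_left l inf_le_right)
  have h7 : Module.finrank k ↥(l ⊔ W ⊓ X ⊔ W ⊓ Y) ≤ Module.finrank k W :=
    Submodule.finrank_mono (sup_le (sup_le hlW inf_le_left) inf_le_left)
  omega

/-- Pair `Fx i` with `Fy (r + 3 - i)`: these have dimensions adding up to `r - 1`. -/
theorem degV_le_of_line_le {k V : Type*} [Field k] [AddCommGroup V] [Module k V]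
    [FiniteDimensional k V] {r : ℕ} {Fx Fy : ℕ → Submodule k V} {l : Submodule k V}
    (h : IsGenericTriple k V r Fx Fy l) {W : Submodule k V} (hlW : l ≤ W) :
    degV k V r Fx Fy W ≤ r * (Module.finrank k W - 1) := by
  obtain ⟨⟨⟨-, hx⟩, ⟨-, hy⟩, -⟩, hl, hgen⟩ := h
  have hsub : Finset.Icc 2 r ⊆ Finset.Icc 2 (r + 1) := Finset.Icc_subset_Icc_right (by omega)
  have hflip : ∑ i ∈ Finset.Icc 2 (r + 1), Module.finrank k ↥(W ⊓ Fy i) =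
      ∑ i ∈ Finset.Icc 2 (r + 1), Module.finrank k ↥(W ⊓ Fy (r + 3 - i)) := by
    refine Finset.sum_nbij' (fun i => r + 3 - i) (fun i => r + 3 - i) ?_ ?_ ?_ ?_ ?_ <;>
      intro i hi <;> rw [Finset.mem_Icc] at hi
    · rw [Finset.mem_Icc]; omega
    · rw [Finset.mem_Icc]; omega
    · omega
    · omega
    · rw [show r + 3 - (r + 3 - i) = i by omega]
  calc degV k V r Fx Fy W
      ≤ ∑ i ∈ Finset.Icc 2 (r + 1), Module.finrank k ↥(W ⊓ Fx i) +
          ∑ i ∈ Finset.Icc 2 (r + 1), Module.finrank k ↥(W ⊓ Fy i) :=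
        add_le_add (Finset.sum_le_sum_of_subset hsub) (Finset.sum_le_sum_of_subset hsub)
    _ = ∑ i ∈ Finset.Icc 2 (r + 1),
          (Module.finrank k ↥(W ⊓ Fx i) + Module.finrank k ↥(W ⊓ Fy (r + 3 - i))) := by
        rw [hflip, Finset.sum_add_distrib]
    _ ≤ ∑ _i ∈ Finset.Icc 2 (r + 1), (Module.finrank k W - 1) := by
        refine Finset.sum_le_sum fun i hi => ?_
        rw [Finset.mem_Icc] at hi
        have hxi := hx i (by omega) (by omega)
        have hyi := hy (r + 3 - i) (by omega) (by omega)
        have hg := hgen i (r + 3 - i) (by omega) (by omega) (by omega) (by omega)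
        have := finrank_add_finrank_inf_add_finrank_inf_le (X := Fx i) (Y := Fy (r + 3 - i))
          hlW (by omega)
        omega
    _ = r * (Module.finrank k W - 1) := by
        rw [Finset.sum_const, Nat.card_Icc, smul_eq_mul]
        congr 1

/-- For a generic triple in an `r`-dimensional space (`r ≥ 2`) and a subspace `W`
containing `l`: `deg(W) ≤ r·(dim W - 1) + (r - 1)`, and `μ(W) ≤ r - 1/dim W`. -/
theorem deg_bound_of_line_le
    (k : Type*) [Field k] (V : Type*) [AddCommGroup V] [Module k V]
    [FiniteDimensional k V] (r : ℕ) (hr : 2 ≤ r) (hV : Module.finrank k V = r)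
    (Fx Fy : ℕ → Submodule k V) (l : Submodule k V)
    (h : IsGenericTriple k V r Fx Fy l)
    (W : Submodule k V) (hlW : l ≤ W) :
    deg k V r Fx Fy l W ≤ r * (Module.finrank k W - 1) + (r - 1) ∧
    (deg k V r Fx Fy l W : ℚ) / (Module.finrank k W : ℚ) ≤
      (r : ℚ) - 1 / (Module.finrank k W : ℚ) := by
  have hl : Module.finrank k l = 1 := h.2.1
  have hW : 1 ≤ Module.finrank k W := hl ▸ Submodule.finrank_mono hlW
  have hdeg : deg k V r Fx Fy l W ≤ r * (Module.finrank k W - 1) + (r - 1) := by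
    rw [deg, inf_eq_left.mpr hlW, hl, mul_one]
    exact Nat.add_le_add_right (degV_le_of_line_le h hlW) _
  refine ⟨hdeg, ?_⟩
  have hW' : (0 : ℚ) < Module.finrank k W := by exact_mod_cast hW
  have hq : (deg k V r Fx Fy l W : ℚ) ≤ r * (Module.finrank k W - 1) + (r - 1) := by
    have hc : (deg k V r Fx Fy l W : ℚ) ≤
        ((r * (Module.finrank k W - 1) + (r - 1) : ℕ) : ℚ) := by exact_mod_cast hdeg
    rwa [Nat.cast_add, Nat.cast_mul, Nat.cast_sub hW, Nat.cast_sub (by omega : 1 ≤ r),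
      Nat.cast_one] at hc
  rw [div_le_iff₀ hW', sub_mul, one_div, inv_mul_cancel₀ hW'.ne']
  linarith
end

section
/- (Proposition 12.1 of the paper, first case.) Let g and M be nonnegative rational numbers with g ≤ M, and let F = F_{g,M} : ℕ → ℚ be defined by F(0) = 0, F(1) = g and F(r) = max over integer decompositions r = s + t with s ≥ 0, t > 0 of F(s) + t²·g + s·t·(g + M). Then for all r ≥ 0 one has F(r) = (r(r+1)/2)·g + (r(r−1)/2)·M. -/
/-- The recursive characterization of the function `F_{g,M} : ℕ → ℚ` of the paper:
`F 0 = 0`, `F 1 = g`, and for `r ≥ 2`, `F r` is the maximum of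
`F s + t²·g + s·t·(g + M)` over integer decompositions `r = s + t`, `s ≥ 0`, `t > 0`. -/
def FRec (g M : ℚ) (F : ℕ → ℚ) : Prop :=
  F 0 = 0 ∧ F 1 = g ∧ ∀ r : ℕ, 2 ≤ r →
    IsGreatest {x : ℚ | ∃ s t : ℕ, s + t = r ∧ 0 < t ∧
      x = F s + (t : ℚ) ^ 2 * g + (s : ℚ) * (t : ℚ) * (g + M)} (F r)

/-- Proposition 12.1, first case: if `0 ≤ g ≤ M` then
`F_{g,M}(r) = (r(r+1)/2)·g + (r(r-1)/2)·M` for all `r`. -/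
theorem F_eq_of_g_le_M (g M : ℚ) (hg : 0 ≤ g) (hM : 0 ≤ M) (hgM : g ≤ M)
    (F : ℕ → ℚ) (hF : FRec g M F) :
    ∀ r : ℕ, F r = (r : ℚ) * ((r : ℚ) + 1) / 2 * g + (r : ℚ) * ((r : ℚ) - 1) / 2 * M := by
  obtain ⟨h0, h1, hrec⟩ := hF
  intro r
  induction r using Nat.strong_induction_on with
  | _ r ih =>
    match r, ih with
    | 0, _ => simp [h0]
    | 1, _ => simp [h1]
    | n + 2, ih =>
      obtain ⟨⟨s, t, hst, ht, hmax⟩, hub⟩ := hrec (n + 2) (by omega)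
      apply le_antisymm
      · rw [hmax, ih s (by omega), ← hst]
        have ht1 : (1 : ℚ) ≤ t := by exact_mod_cast ht
        have hgap : 0 ≤ (M - g) * ((t : ℚ) * (t - 1)) :=
          mul_nonneg (sub_nonneg.2 hgM) (mul_nonneg (by positivity) (sub_nonneg.2 ht1))
        push_cast
        linarith
      · refine le_trans (le_of_eq ?_) (hub ⟨n + 1, 1, rfl, one_pos, rfl⟩)
        rw [ih (n + 1) (by omega)]
        push_cast
        ring
end

section
/- (Proposition 12.1 of the paper, second case.) Let g and M be nonnegative rational numbers with g ≥ M, and let F = F_{g,M} : ℕ → ℚ be defined by F(0) = 0, F(1) = g and F(r) = max over integer decompositions r = s + t with s ≥ 0, t > 0 of F(s) + t²·g + s·t·(g + M). Then for all r ≥ 0 one has F(r) = r²·g. -/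
/-- Proposition 12.1, second case: if `0 ≤ M ≤ g` then `F_{g,M}(r) = r²·g` for all `r`. -/
theorem F_eq_of_M_le_g (g M : ℚ) (hg : 0 ≤ g) (hM : 0 ≤ M) (hMg : M ≤ g)
    (F : ℕ → ℚ) (hF : FRec g M F) :
    ∀ r : ℕ, F r = (r : ℚ) ^ 2 * g := by
  obtain ⟨h0, h1, h⟩ := hF
  intro r
  induction r using Nat.strong_induction_on with
  | _ r ih =>
    obtain rfl | rfl | hr : r = 0 ∨ r = 1 ∨ 2 ≤ r := by omega
    · simp [h0]
    · simp [h1]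
    · apply le_antisymm
      · obtain ⟨s, t, rfl, ht, hx⟩ := (h r hr).1
        rw [hx, ih s (by omega)]
        have hst : (s : ℚ) * t * M ≤ s * t * g := by gcongr
        push_cast
        linarith
      · exact (h r hr).2 ⟨0, r, by omega, by omega, by simp [h0]⟩
end

section
/- Let g and M be nonnegative rational numbers and F = F_{g,M} : ℕ → ℚ the recursively defined function. Then F is superadditive with defect (g+M)st: for all integers s, t with 0 < s ≤ t one has F(s + t) − F(s) − F(t) − (g + M)·s·t ≥ 0. -/
namespace FRec

variable {g M : ℚ} {F : ℕ → ℚ}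

/-- Every decomposition `s + t` with `t > 0` gives a lower bound for `F (s + t)`. -/
theorem le_add (hF : FRec g M F) (s : ℕ) {t : ℕ} (ht : 0 < t) :
    F s + (t : ℚ) ^ 2 * g + (s : ℚ) * (t : ℚ) * (g + M) ≤ F (s + t) := by
  obtain ⟨h0, h1, hr⟩ := hF
  by_cases h : 2 ≤ s + t
  · exact (hr _ h).2 ⟨s, t, rfl, ht, rfl⟩
  · obtain rfl : s = 0 := by lia
    obtain rfl : t = 1 := by lia
    simp [h0, h1]

/-- For `r > 0`, the value `F r` is attained at some decomposition. -/
theorem exists_eq (hF : FRec g M F) {r : ℕ} (hr : 0 < r) :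
    ∃ s t : ℕ, s + t = r ∧ 0 < t ∧
      F r = F s + (t : ℚ) ^ 2 * g + (s : ℚ) * (t : ℚ) * (g + M) := by
  obtain ⟨h0, h1, h⟩ := hF
  by_cases h2 : 2 ≤ r
  · exact (h r h2).1
  · obtain rfl : r = 1 := by lia
    exact ⟨0, 1, rfl, one_pos, by simp [h0, h1]⟩

theorem add_le (hF : FRec g M F) (s t : ℕ) :
    F s + F t + (g + M) * (s : ℚ) * (t : ℚ) ≤ F (s + t) := by
  induction t using Nat.strong_induction_on with
  | _ t ih =>
    rcases Nat.eq_zero_or_pos t with rfl | ht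
    · simp [hF.1]
    · obtain ⟨a, b, rfl, hb, hab⟩ := hF.exists_eq ht
      have h₁ := ih a (by lia)
      have h₂ := hF.le_add (s + a) hb
      rw [Nat.add_assoc] at h₂
      push_cast at h₂ ⊢
      linarith

end FRec

/-- `F_{g,M}` is superadditive with defect `(g+M)·s·t`: for all integers `0 < s ≤ t`,
`F(s+t) - F(s) - F(t) - (g+M)·s·t ≥ 0`. -/
theorem F_superadditive (g M : ℚ) (hg : 0 ≤ g) (hM : 0 ≤ M)
    (F : ℕ → ℚ) (hF : FRec g M F) :
    ∀ s t : ℕ, 0 < s → s ≤ t →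
      F (s + t) - F s - F t - (g + M) * (s : ℚ) * (t : ℚ) ≥ 0 := by
  intro s t _ _
  linarith [hF.add_le s t]
end

section
/- (Proposition 12.2 of the paper.) Let g and M be nonnegative rational numbers. Define F = F_{g,M} : ℕ → ℚ by F(0) = 0, F(1) = g and F(r) = max_{s+t=r, s≥0, t>0} ( F(s) + t²·g + st(g+M) ), and define G = G_{g,M} : ℕ → ℚ by G(0) = 0, G(1) = g and G(r) = max_{s+t=r, s≥0, t>0} ( F(t) + G(s) + st(g+M) ). Then F(r) = G(r) for all r ≥ 0. -/
/-- The recursive characterization of the function `G_{g,M} : ℕ → ℚ` of the paper: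
`G 0 = 0`, `G 1 = g`, and for `r ≥ 2`, `G r` is the maximum of
`F t + G s + s·t·(g + M)` over integer decompositions `r = s + t`, `s ≥ 0`, `t > 0`. -/
def GRec (g M : ℚ) (F G : ℕ → ℚ) : Prop :=
  G 0 = 0 ∧ G 1 = g ∧ ∀ r : ℕ, 2 ≤ r →
    IsGreatest {x : ℚ | ∃ s t : ℕ, s + t = r ∧ 0 < t ∧
      x = F t + G s + (s : ℚ) * (t : ℚ) * (g + M)} (G r)

/-- The recursion for `F` also holds at `r = 1`, hence for all `r > 0`. -/
theorem FRec.isGreatest {g M : ℚ} {F : ℕ → ℚ} (hF : FRec g M F) {r : ℕ} (hr : 0 < r) :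
    IsGreatest {x : ℚ | ∃ s t : ℕ, s + t = r ∧ 0 < t ∧
      x = F s + (t : ℚ) ^ 2 * g + (s : ℚ) * (t : ℚ) * (g + M)} (F r) := by
  obtain ⟨h0, h1, h⟩ := hF
  rcases Nat.lt_or_ge r 2 with h2 | h2
  · obtain rfl : r = 1 := by omega
    refine ⟨⟨0, 1, rfl, one_pos, by simp [h0, h1]⟩, ?_⟩
    rintro x ⟨s, t, hst, ht, rfl⟩
    obtain ⟨rfl, rfl⟩ : s = 0 ∧ t = 1 := by omega
    simp [h0, h1]
  · exact h r h2

/-- `F` is superadditive up to the cross term `s·t·(g + M)`. -/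
theorem FRec.add_le_s12 {g M : ℚ} {F : ℕ → ℚ} (hF : FRec g M F) (s t : ℕ) :
    F t + F s + (s : ℚ) * (t : ℚ) * (g + M) ≤ F (s + t) := by
  induction t using Nat.strong_induction_on with
  | _ t ih =>
    rcases Nat.eq_zero_or_pos t with rfl | ht
    · simp [hF.1]
    · obtain ⟨a, b, hab, hb, hFt⟩ := (hF.isGreatest ht).1
      have hsa := ih a (by omega)
      have hle := (hF.isGreatest (r := s + t) (by omega)).2
        ⟨s + a, b, by omega, hb, rfl⟩
      subst hab
      push_cast at hle ⊢
      linarith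

/-- Proposition 12.2: `F_{g,M}(r) = G_{g,M}(r)` for all `r ≥ 0`. -/
theorem F_eq_G (g M : ℚ) (hg : 0 ≤ g) (hM : 0 ≤ M)
    (F G : ℕ → ℚ) (hF : FRec g M F) (hG : GRec g M F G) :
    ∀ r : ℕ, F r = G r := by
  obtain ⟨hG0, hG1, hG⟩ := hG
  intro r
  induction r using Nat.strong_induction_on with
  | _ r ih =>
    rcases Nat.lt_or_ge r 2 with h2 | h2
    · interval_cases r
      · rw [hF.1, hG0]
      · rw [hF.2.1, hG1]
    · apply le_antisymm
      · exact (hG r h2).2 ⟨0, r, by omega, by omega, by simp [hG0]⟩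
      · obtain ⟨s, t, rfl, ht, hGr⟩ := (hG r h2).1
        rw [hGr, ← ih s (by omega)]
        exact hF.add_le_s12 s t
end

section
/- Let g and M be nonnegative rational numbers with M ≤ g, and let G = G_{g,M} : ℕ → ℚ be the recursively defined function. Then G(r) = r²·g for all r ≥ 0. (This is the combination of Propositions 12.1 and 12.2 of the paper used in Remark 12.3 to conclude that the essential dimension of the moduli stack of vector bundles of rank r and degree d on a curve of genus g ≥ 2 is at most r²g.) -/
/-- If `M ≤ g`, the recursion for `F_{g,M}` is solved by `r ↦ r²·g`. -/
theorem FRec.eq_sq_mul {g M : ℚ} {F : ℕ → ℚ} (hF : FRec g M F) (hMg : M ≤ g) (r : ℕ) :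
    F r = (r : ℚ) ^ 2 * g := by
  obtain ⟨h0, h1, hrec⟩ := hF
  induction r using Nat.strong_induction_on with
  | _ r ih =>
    rcases Nat.lt_or_ge r 2 with hr | hr
    · interval_cases r <;> simp [h0, h1]
    · refine (hrec r hr).unique ⟨⟨0, r, by omega, by omega, by simp [h0]⟩, ?_⟩
      rintro x ⟨s, t, rfl, ht, rfl⟩
      rw [ih s (by omega)]
      have hst : (0 : ℚ) ≤ s * t * (g - M) := mul_nonneg (by positivity) (sub_nonneg.2 hMg)
      push_cast
      linarith

/-- When `F_{g,M}` is `r ↦ r²·g`, the recursion for `G_{g,M}` is that for `F_{g,M}`. -/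
theorem GRec.toFRec {g M : ℚ} {F G : ℕ → ℚ} (hG : GRec g M F G)
    (hF : ∀ r : ℕ, F r = (r : ℚ) ^ 2 * g) : FRec g M G := by
  simpa only [GRec, FRec, hF, add_comm (_ ^ 2 * g)] using hG

/-- If `0 ≤ M ≤ g` then `G_{g,M}(r) = r²·g` for all `r ≥ 0`. -/
theorem G_eq_of_M_le_g (g M : ℚ) (hg : 0 ≤ g) (hM : 0 ≤ M) (hMg : M ≤ g)
    (F G : ℕ → ℚ) (hF : FRec g M F) (hG : GRec g M F G) :
    ∀ r : ℕ, G r = (r : ℚ) ^ 2 * g :=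
  (hG.toFRec (hF.eq_sq_mul hMg)).eq_sq_mul hMg
end

section
/- (Lemma 9.3 of the paper, stated after Frobenius reciprocity.) Let k be an algebraically closed field of characteristic zero, C a finite cyclic group of order m with generator γ, and N a positive integer. Let V be a finite-dimensional k-linear representation of C on which γ^N acts as the identity, and let T be a one-dimensional k-linear representation of C which is faithful. Then Σ_{d=0}^{m−1} d · dim_k ( (V ⊗ T^{⊗d})^C ) ≤ dim_k(V) · m · (1 − 1/N), where (·)^C denotes the subspace of C-invariant vectors. -/
/-- Independent subspaces of a finite-dimensional space have total dimension at most that of the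
ambient space. -/
theorem iSupIndep.sum_finrank_le {ι k V : Type*} [Fintype ι] [Field k] [AddCommGroup V]
    [Module k V] [FiniteDimensional k V] {W : ι → Submodule k V} (hW : iSupIndep W) :
    ∑ i, Module.finrank k (W i) ≤ Module.finrank k V := by
  classical
  rw [← Module.finrank_directSum]
  exact LinearMap.finrank_le_finrank_of_injective hW.dfinsupp_lsum_injective

/-- A multiple of `m` strictly below `m * N` is at most `m * (N - 1)`. -/
theorem cast_le_mul_one_sub_inv_of_dvd_mul {d m N : ℕ} (hN : 0 < N) (hd : d < m)
    (h : m ∣ d * N) : (d : ℚ) ≤ m * (1 - 1 / (N : ℚ)) := by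
  obtain ⟨c, hc⟩ := h
  have hcN : c + 1 ≤ N := by
    have : m * c < m * N := hc ▸ Nat.mul_lt_mul_of_pos_right hd hN
    exact lt_of_mul_lt_mul_left' this
  have hle : d * N + m ≤ m * N := by
    rw [hc]
    nlinarith
  have hN' : (0 : ℚ) < N := by exact_mod_cast hN
  have hle' : (d : ℚ) * N + m ≤ m * N := by exact_mod_cast hle
  rw [← mul_le_mul_iff_left₀ hN']
  have : (m : ℚ) * (1 - 1 / (N : ℚ)) * N = m * N - m := by field_simp
  linarith


/-- Lemma 9.3 (after Frobenius reciprocity): let `k` be an algebraically closed field of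
characteristic zero, `C` a finite cyclic group of order `m` generated by `γ`, `N > 0`,
`V` a finite-dimensional representation `ρ` of `C` on which `γ^N` acts trivially, and
`τ : C →* kˣ` a faithful one-dimensional representation. Then
`Σ_{d=0}^{m-1} d · dim (V ⊗ T^d)^C ≤ dim V · m · (1 - 1/N)`, where the invariants of
`V ⊗ T^d` are the vectors `v` with `τ(c)^d • ρ(c) v = v` for all `c ∈ C`. -/
theorem twisted_invariants_dim_bound
    (k : Type*) [Field k] [IsAlgClosed k] [CharZero k]
    (C : Type*) [Group C] [Fintype C] (m : ℕ) (hm : Fintype.card C = m)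
    (γ : C) (hγ : ∀ c : C, c ∈ Subgroup.zpowers γ)
    (N : ℕ) (hN : 0 < N)
    (V : Type*) [AddCommGroup V] [Module k V] [FiniteDimensional k V]
    (ρ : Representation k C V) (hρN : ρ (γ ^ N) = 1)
    (τ : C →* kˣ) (hτ : Function.Injective τ) :
    ∑ d ∈ Finset.range m, (d : ℚ) *
        (Module.finrank k
          ↥(⨅ c : C, LinearMap.ker (((τ c : k) ^ d) • ρ c - LinearMap.id)) : ℚ) ≤
      (Module.finrank k V : ℚ) * (m : ℚ) * (1 - 1 / (N : ℚ)) := by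
  have hγm : orderOf γ = m := by
    rw [orderOf_eq_card_of_forall_mem_zpowers hγ, Nat.card_eq_fintype_card, hm]
  have hζ : IsPrimitiveRoot ((τ γ : k)) m := by
    rw [IsPrimitiveRoot.coe_units_iff, ← hγm, ← orderOf_injective τ hτ γ]
    exact IsPrimitiveRoot.orderOf _
  set W : ℕ → Submodule k V :=
    fun d ↦ ⨅ c : C, LinearMap.ker (((τ c : k) ^ d) • ρ c - LinearMap.id)
  have hW : ∀ d, W d ≤ Module.End.eigenspace (ρ γ) ((τ γ : k)⁻¹ ^ d) := by
    intro d v hv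
    have hv' : ((τ γ : k) ^ d) • ρ γ v = v := by
      simpa [sub_eq_zero] using (Submodule.mem_iInf _).mp hv γ
    rw [Module.End.mem_eigenspace_iff, inv_pow, eq_inv_smul_iff₀ (pow_ne_zero _ (τ γ).ne_zero)]
    exact hv'
  have hinj : Function.Injective fun d : Fin m ↦ (τ γ : k)⁻¹ ^ (d : ℕ) := fun a b hab ↦
    Fin.ext (hζ.inv.pow_inj a.2 b.2 hab)
  have hsum : ∑ d ∈ Finset.range m, (Module.finrank k (W d) : ℚ) ≤ Module.finrank k V := by
    have hind : iSupIndep fun d : Fin m ↦ W d :=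
      ((Module.End.eigenspaces_iSupIndep (ρ γ)).comp hinj).mono fun d ↦ hW d
    rw [Finset.sum_range]
    exact_mod_cast hind.sum_finrank_le
  have hdvd : ∀ d, W d ≠ ⊥ → m ∣ d * N := by
    intro d hd
    obtain ⟨v, hv, hv0⟩ := (Submodule.ne_bot_iff _).mp hd
    have hev : Module.End.HasEigenvector (ρ γ) ((τ γ : k)⁻¹ ^ d) v := ⟨hW d hv, hv0⟩
    have hpow := hev.pow_apply N
    rw [← map_pow, hρN, Module.End.one_apply, ← pow_mul] at hpow
    refine (hζ.inv.pow_eq_one_iff_dvd _).mp (smul_left_injective k hv0 ?_)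
    simpa using hpow.symm
  have hN1 : (0 : ℚ) ≤ m * (1 - 1 / (N : ℚ)) := by
    have : 1 / (N : ℚ) ≤ 1 := by
      rw [div_le_one (by exact_mod_cast hN)]
      exact_mod_cast hN
    exact mul_nonneg m.cast_nonneg (sub_nonneg.mpr this)
  calc ∑ d ∈ Finset.range m, (d : ℚ) * (Module.finrank k (W d) : ℚ)
      ≤ ∑ d ∈ Finset.range m, m * (1 - 1 / (N : ℚ)) * (Module.finrank k (W d) : ℚ) := by
        refine Finset.sum_le_sum fun d hd ↦ ?_
        by_cases hbot : W d = ⊥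
        · rw [show Module.finrank k (W d) = 0 by rw [hbot, finrank_bot]]
          simp
        · exact mul_le_mul_of_nonneg_right (cast_le_mul_one_sub_inv_of_dvd_mul hN
            (Finset.mem_range.mp hd) (hdvd d hbot)) (Nat.cast_nonneg _)
    _ ≤ m * (1 - 1 / (N : ℚ)) * Module.finrank k V := by
        rw [← Finset.mul_sum]
        exact mul_le_mul_of_nonneg_left hsum hN1
    _ = (Module.finrank k V : ℚ) * (m : ℚ) * (1 - 1 / (N : ℚ)) := by ring
end
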